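/- The class of lattice path matroids is closed under direct sums: if M_1 and M_2 are lattice path matroids on disjoint ground sets E_1 and E_2 (i.e., each M_i is isomorphic to some M[P_i,Q_i]), then the direct sum M_1 ⊕ M_2, the matroid on E_1 ∪ E_2 whose bases are {B_1 ∪ B_2 : B_1 a basis of M_1, B_2 a basis of M_2}, is again a lattice path matroid. -/

import Mathlib

/-- Number of North steps among the first `i` steps of the lattice path `P`
(steps are indexed `1, …, n`; `P j = true` means step `j` is a North step). -/
def NCt (P : ℕ → Bool) (i : ℕ) : ℕ :=
  ((Finset.Icc 1 i).filter (fun j => P j = true)).card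

/-- `P` is a lattice path from `(0,0)` to `(m,r)`: it has exactly `r` North steps
among its `m + r` steps. -/
def IsPath (m r : ℕ) (P : ℕ → Bool) : Prop := NCt P (m + r) = r

/-- `P` never goes above `Q`. -/
def Below (n : ℕ) (P Q : ℕ → Bool) : Prop := ∀ i ≤ n, NCt P i ≤ NCt Q i

/-- `B` is a basis of the lattice path matroid `M[P,Q]`: an `r`-element subset of
`{1, …, m+r}` whose associated lattice path stays between `P` and `Q`. -/
def IsLPBasis (m r : ℕ) (P Q : ℕ → Bool) (B : Finset ℕ) : Prop :=
  B ⊆ Finset.Icc 1 (m + r) ∧ B.card = r ∧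
    ∀ i ≤ m + r, NCt P i ≤ (B.filter (fun j => j ≤ i)).card ∧
      (B.filter (fun j => j ≤ i)).card ≤ NCt Q i

/-- `Bs` (the set of bases of a matroid on ground set `E`) is a lattice path
matroid: there are bounding lattice paths `P`, `Q` and a bijection from `E` to
`{1,…,m+r}` carrying the bases onto the bases of `M[P,Q]`. -/
def IsLatticePathMatroid {E : Type*} (Bs : Set (Finset E)) : Prop :=
  ∃ (m r : ℕ) (P Q : ℕ → Bool), IsPath m r P ∧ IsPath m r Q ∧ Below (m + r) P Q ∧
    ∃ φ : E → ℕ, Set.BijOn φ Set.univ ↑(Finset.Icc 1 (m + r)) ∧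
      ∀ B : Finset E, B ∈ Bs ↔ IsLPBasis m r P Q (B.image φ)

/-- The path that follows `P₁` for its first `n` steps and then follows `P₂`. -/
def concatPath (n : ℕ) (P₁ P₂ : ℕ → Bool) (j : ℕ) : Bool :=
  if j ≤ n then P₁ j else P₂ (j - n)

/-- The image of `A₁ ⊔ A₂` when `A₂` is placed after the interval `{1, …, n}`. -/
def concatSet (n : ℕ) (A₁ A₂ : Finset ℕ) : Finset ℕ :=
  A₁ ∪ A₂.image (n + ·)

theorem NCt_zero (P : ℕ → Bool) : NCt P 0 = 0 := by
  simp [NCt]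

theorem NCt_succ (P : ℕ → Bool) (i : ℕ) :
    NCt P (i + 1) = NCt P i + if P (i + 1) = true then 1 else 0 := by
  unfold NCt
  rw [← Finset.insert_Icc_right_eq_Icc_add_one (by omega), Finset.filter_insert]
  split_ifs
  · rw [Finset.card_insert_of_notMem (by simp)]
  · rfl

theorem NCt_concatPath_of_le (n : ℕ) (P₁ P₂ : ℕ → Bool) {i : ℕ} (hi : i ≤ n) :
    NCt (concatPath n P₁ P₂) i = NCt P₁ i := by
  induction i with
  | zero => simp [NCt_zero]
  | succ i ih => simp [NCt_succ, ih (by omega), concatPath, hi]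

theorem NCt_concatPath_add (n : ℕ) (P₁ P₂ : ℕ → Bool) (k : ℕ) :
    NCt (concatPath n P₁ P₂) (n + k) = NCt P₁ n + NCt P₂ k := by
  induction k with
  | zero => simp [NCt_zero, NCt_concatPath_of_le]
  | succ k ih =>
    have h : concatPath n P₁ P₂ (n + k + 1) = P₂ (k + 1) := by
      simp [concatPath, show ¬ n + k + 1 ≤ n by omega, show n + k + 1 - n = k + 1 by omega]
    rw [← add_assoc, NCt_succ, NCt_succ, ih, h, add_assoc]

theorem card_filter_concatSet_of_le {n : ℕ} (A₁ : Finset ℕ) {A₂ : Finset ℕ}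
    (h₂ : ∀ j ∈ A₂, 1 ≤ j) {i : ℕ} (hi : i ≤ n) :
    ((concatSet n A₁ A₂).filter (fun j => j ≤ i)).card =
      (A₁.filter (fun j => j ≤ i)).card := by
  congr 1
  ext j
  simp only [concatSet, Finset.mem_filter, Finset.mem_union, Finset.mem_image]
  constructor
  · rintro ⟨h | ⟨a, ha, rfl⟩, hj⟩
    · exact ⟨h, hj⟩
    · have := h₂ a ha
      omega
  · exact fun h => ⟨Or.inl h.1, h.2⟩

theorem card_filter_concatSet_add {n : ℕ} {A₁ A₂ : Finset ℕ} (h₁ : ∀ j ∈ A₁, j ≤ n)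
    (h₂ : ∀ j ∈ A₂, 1 ≤ j) (k : ℕ) :
    ((concatSet n A₁ A₂).filter (fun j => j ≤ n + k)).card =
      A₁.card + (A₂.filter (fun j => j ≤ k)).card := by
  have hd : Disjoint A₁ ((A₂.filter (fun j => j ≤ k)).image (n + ·)) := by
    rw [Finset.disjoint_left]
    intro j hj hj'
    obtain ⟨a, ha, rfl⟩ := Finset.mem_image.1 hj'
    have := h₁ _ hj
    have := h₂ a (Finset.mem_filter.1 ha).1
    omega
  rw [concatSet, Finset.filter_union, Finset.filter_image,
    Finset.filter_true_of_mem (fun j hj => (h₁ j hj).trans (Nat.le_add_right n k))]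
  simp only [Nat.add_le_add_iff_left]
  rw [Finset.card_union_of_disjoint hd,
    Finset.card_image_of_injective _ (add_right_injective n)]

theorem concatSet_subset_Icc {n₁ n₂ : ℕ} {A₁ A₂ : Finset ℕ} (h₁ : A₁ ⊆ Finset.Icc 1 n₁)
    (h₂ : A₂ ⊆ Finset.Icc 1 n₂) : concatSet n₁ A₁ A₂ ⊆ Finset.Icc 1 (n₁ + n₂) := by
  intro j hj
  rw [Finset.mem_Icc]
  rcases Finset.mem_union.1 hj with h | h
  · have := Finset.mem_Icc.1 (h₁ h)
    omega
  · obtain ⟨a, ha, rfl⟩ := Finset.mem_image.1 h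
    have := Finset.mem_Icc.1 (h₂ ha)
    omega

theorem card_filter_le_eq_card {n : ℕ} {A : Finset ℕ} (h : A ⊆ Finset.Icc 1 n) :
    (A.filter (fun j => j ≤ n)).card = A.card := by
  rw [Finset.filter_true_of_mem fun j hj => (Finset.mem_Icc.1 (h hj)).2]

theorem isLPBasis_concat_iff {m₁ r₁ m₂ r₂ : ℕ} {P₁ Q₁ P₂ Q₂ : ℕ → Bool}
    (hP₁ : IsPath m₁ r₁ P₁) (hQ₁ : IsPath m₁ r₁ Q₁) {A₁ A₂ : Finset ℕ}
    (h₁ : A₁ ⊆ Finset.Icc 1 (m₁ + r₁)) (h₂ : A₂ ⊆ Finset.Icc 1 (m₂ + r₂)) :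
    IsLPBasis (m₁ + m₂) (r₁ + r₂) (concatPath (m₁ + r₁) P₁ P₂) (concatPath (m₁ + r₁) Q₁ Q₂)
        (concatSet (m₁ + r₁) A₁ A₂) ↔
      IsLPBasis m₁ r₁ P₁ Q₁ A₁ ∧ IsLPBasis m₂ r₂ P₂ Q₂ A₂ := by
  have hn : m₁ + m₂ + (r₁ + r₂) = m₁ + r₁ + (m₂ + r₂) := by omega
  have hle₁ : ∀ j ∈ A₁, j ≤ m₁ + r₁ := fun j hj => (Finset.mem_Icc.1 (h₁ hj)).2
  have hle₂ : ∀ j ∈ A₂, 1 ≤ j := fun j hj => (Finset.mem_Icc.1 (h₂ hj)).1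
  have hsub := concatSet_subset_Icc h₁ h₂
  have hcard : (concatSet (m₁ + r₁) A₁ A₂).card = A₁.card + A₂.card := by
    rw [← card_filter_le_eq_card hsub, card_filter_concatSet_add hle₁ hle₂,
      card_filter_le_eq_card h₂]
  unfold IsPath at hP₁ hQ₁
  unfold IsLPBasis
  rw [hn, hcard]
  constructor
  · rintro ⟨-, hc, hb⟩
    have hb₁ : ∀ i ≤ m₁ + r₁, NCt P₁ i ≤ (A₁.filter (fun j => j ≤ i)).card ∧
        (A₁.filter (fun j => j ≤ i)).card ≤ NCt Q₁ i := by
      intro i hi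
      have := hb i (by omega)
      rwa [NCt_concatPath_of_le _ _ _ hi, NCt_concatPath_of_le _ _ _ hi,
        card_filter_concatSet_of_le _ hle₂ hi] at this
    have hc₁ : A₁.card = r₁ := by
      have := hb₁ _ le_rfl
      rw [card_filter_le_eq_card h₁] at this
      omega
    refine ⟨⟨h₁, hc₁, hb₁⟩, h₂, by omega, fun i hi => ?_⟩
    have := hb (m₁ + r₁ + i) (by omega)
    rw [NCt_concatPath_add, NCt_concatPath_add, card_filter_concatSet_add hle₁ hle₂] at this
    omega
  · rintro ⟨⟨-, hc₁, hb₁⟩, -, hc₂, hb₂⟩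
    refine ⟨hsub, by omega, fun i hi => ?_⟩
    rcases le_total i (m₁ + r₁) with h | h
    · rw [NCt_concatPath_of_le _ _ _ h, NCt_concatPath_of_le _ _ _ h,
        card_filter_concatSet_of_le _ hle₂ h]
      exact hb₁ i h
    · obtain ⟨k, rfl⟩ := Nat.exists_eq_add_of_le h
      have := hb₂ k (by omega)
      rw [NCt_concatPath_add, NCt_concatPath_add, card_filter_concatSet_add hle₁ hle₂]
      omega

theorem IsPath.concat {m₁ r₁ m₂ r₂ : ℕ} {P₁ P₂ : ℕ → Bool} (h₁ : IsPath m₁ r₁ P₁)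
    (h₂ : IsPath m₂ r₂ P₂) :
    IsPath (m₁ + m₂) (r₁ + r₂) (concatPath (m₁ + r₁) P₁ P₂) := by
  unfold IsPath at *
  rw [show m₁ + m₂ + (r₁ + r₂) = m₁ + r₁ + (m₂ + r₂) by omega, NCt_concatPath_add, h₁, h₂]

theorem Below.concat {n₁ n₂ : ℕ} {P₁ Q₁ P₂ Q₂ : ℕ → Bool} (h₁ : Below n₁ P₁ Q₁)
    (h₂ : Below n₂ P₂ Q₂) :
    Below (n₁ + n₂) (concatPath n₁ P₁ P₂) (concatPath n₁ Q₁ Q₂) := by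
  intro i hi
  rcases le_total i n₁ with h | h
  · rw [NCt_concatPath_of_le _ _ _ h, NCt_concatPath_of_le _ _ _ h]
    exact h₁ i h
  · obtain ⟨k, rfl⟩ := Nat.exists_eq_add_of_le h
    rw [NCt_concatPath_add, NCt_concatPath_add]
    exact add_le_add (h₁ _ le_rfl) (h₂ k (by omega))

theorem bijOn_sumElim_Icc {E₁ E₂ : Type*} {n₁ n₂ : ℕ} {φ₁ : E₁ → ℕ} {φ₂ : E₂ → ℕ}
    (h₁ : Set.BijOn φ₁ Set.univ ↑(Finset.Icc 1 n₁))
    (h₂ : Set.BijOn φ₂ Set.univ ↑(Finset.Icc 1 n₂)) :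
    Set.BijOn (Sum.elim φ₁ fun e => n₁ + φ₂ e) Set.univ ↑(Finset.Icc 1 (n₁ + n₂)) := by
  rw [Finset.coe_Icc] at *
  have hm₁ : ∀ e, 1 ≤ φ₁ e ∧ φ₁ e ≤ n₁ := fun e => h₁.mapsTo (Set.mem_univ e)
  have hm₂ : ∀ e, 1 ≤ φ₂ e ∧ φ₂ e ≤ n₂ := fun e => h₂.mapsTo (Set.mem_univ e)
  refine ⟨?_, ?_, ?_⟩
  · rintro (e | e) -
    · have := hm₁ e
      simp only [Sum.elim_inl, Set.mem_Icc]
      omega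
    · have := hm₂ e
      simp only [Sum.elim_inr, Set.mem_Icc]
      omega
  · refine Set.injOn_univ.2 ((Set.injOn_univ.1 h₁.injOn).sumElim
      ((add_right_injective n₁).comp (Set.injOn_univ.1 h₂.injOn)) fun a b => ?_)
    have := hm₁ a
    have := hm₂ b
    omega
  · rintro j ⟨hj₁, hj₂⟩
    rcases le_or_gt j n₁ with h | h
    · obtain ⟨e, -, he⟩ := h₁.surjOn ⟨hj₁, h⟩
      exact ⟨Sum.inl e, Set.mem_univ _, he⟩
    · obtain ⟨e, -, he⟩ := h₂.surjOn (a := j - n₁) ⟨by omega, by omega⟩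
      refine ⟨Sum.inr e, Set.mem_univ _, ?_⟩
      simp only [Sum.elim_inr, he]
      omega

theorem image_sumElim_eq_concatSet {E₁ E₂ : Type*} (n : ℕ) (φ₁ : E₁ → ℕ) (φ₂ : E₂ → ℕ)
    (B : Finset (E₁ ⊕ E₂)) :
    B.image (Sum.elim φ₁ fun e => n + φ₂ e) =
      concatSet n (B.toLeft.image φ₁) (B.toRight.image φ₂) := by
  ext j
  simp [concatSet]

theorem exists_eq_map_union_map_iff {E₁ E₂ : Type*} [DecidableEq E₁] [DecidableEq E₂]
    (Bs₁ : Set (Finset E₁)) (Bs₂ : Set (Finset E₂)) (B : Finset (E₁ ⊕ E₂)) :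
    (∃ B₁ ∈ Bs₁, ∃ B₂ ∈ Bs₂,
        B = B₁.map ⟨Sum.inl, Sum.inl_injective⟩ ∪ B₂.map ⟨Sum.inr, Sum.inr_injective⟩) ↔
      B.toLeft ∈ Bs₁ ∧ B.toRight ∈ Bs₂ := by
  constructor
  · rintro ⟨B₁, h₁, B₂, h₂, rfl⟩
    constructor
    · convert h₁
      ext
      simp
    · convert h₂
      ext
      simp
  · rintro ⟨h₁, h₂⟩
    refine ⟨_, h₁, _, h₂, ?_⟩
    ext (e | e) <;> simp

/-- The class of lattice path matroids is closed under direct sums. -/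
theorem lpm_directSum {E₁ E₂ : Type*} [DecidableEq E₁] [DecidableEq E₂]
    (Bs₁ : Set (Finset E₁)) (Bs₂ : Set (Finset E₂))
    (h₁ : IsLatticePathMatroid Bs₁) (h₂ : IsLatticePathMatroid Bs₂) :
    IsLatticePathMatroid
      {B : Finset (E₁ ⊕ E₂) | ∃ B₁ ∈ Bs₁, ∃ B₂ ∈ Bs₂,
        B = B₁.map ⟨Sum.inl, Sum.inl_injective⟩ ∪ B₂.map ⟨Sum.inr, Sum.inr_injective⟩} := by
  obtain ⟨m₁, r₁, P₁, Q₁, hP₁, hQ₁, hb₁, φ₁, hφ₁, hB₁⟩ := h₁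
  obtain ⟨m₂, r₂, P₂, Q₂, hP₂, hQ₂, hb₂, φ₂, hφ₂, hB₂⟩ := h₂
  have hn : m₁ + m₂ + (r₁ + r₂) = m₁ + r₁ + (m₂ + r₂) := by omega
  refine ⟨m₁ + m₂, r₁ + r₂, concatPath (m₁ + r₁) P₁ P₂, concatPath (m₁ + r₁) Q₁ Q₂,
    hP₁.concat hP₂, hQ₁.concat hQ₂, hn ▸ hb₁.concat hb₂,
    Sum.elim φ₁ fun e => m₁ + r₁ + φ₂ e, hn ▸ bijOn_sumElim_Icc hφ₁ hφ₂, fun B => ?_⟩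
  rw [Set.mem_ofPred_eq, exists_eq_map_union_map_iff, hB₁, hB₂, image_sumElim_eq_concatSet,
    isLPBasis_concat_iff hP₁ hQ₁
      (Finset.image_subset_iff.2 fun e _ => hφ₁.mapsTo (Set.mem_univ e))
      (Finset.image_subset_iff.2 fun e _ => hφ₂.mapsTo (Set.mem_univ e))]
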